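/- Let π₁, π₂, π₃, π₄ be the permutations of {1,…,9} determined by the bottom-line words (7,6,5,4,3,9,8,2,1), (6,5,4,3,7,9,8,2,1), (4,3,5,7,6,9,8,2,1) and (4,3,6,5,7,9,8,2,1) respectively. All four are irreducible; π₁ and π₂ belong to the same extended Rauzy class, π₃ and π₄ belong to the same extended Rauzy class, and these two extended Rauzy classes are distinct. (They correspond to the even-spin and odd-spin connected components of the stratum H(2,4) of Abelian differentials in genus 4.) -/

import Mathlib

/-- The auxiliary permutation `q m` of `Fin n` (`0`-indexed version of the
renumbering used in the Rauzy operations): it fixes every `j ≤ m`, sends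
`j ↦ j + 1` for `m < j < n - 1`, and sends the last index `n - 1` to `m + 1`.
(When `m = n - 1` it is the identity.) -/
def rauzyQ {n : ℕ} (m : Fin n) : Equiv.Perm (Fin n) :=
  (Fin.revPerm * Fin.cycleRange ⟨n - 2 - m.val, by have := m.isLt; omega⟩ * Fin.revPerm)⁻¹

/-- Rauzy operation `a`: in the two-line representation of `π` (top line
`(0, …, n-1)`, bottom line `(π⁻¹ 0, …, π⁻¹ (n-1))`) one deletes the last entry
of the bottom line and reinserts it immediately to the right of the entry
`n - 1` of the bottom line.  In terms of permutations this is
`a(π) = q (π (n-1)) ∘ π`. -/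
def rauzyA {n : ℕ} (π : Equiv.Perm (Fin n)) : Equiv.Perm (Fin n) :=
  if h : n = 0 then π else rauzyQ (π ⟨n - 1, by omega⟩) * π

/-- Rauzy operation `b`: one deletes the last entry `n - 1` of the top line,
reinserts it immediately to the right of the entry `π⁻¹ (n-1)` of the top line
and relabels the symbols in the order of their appearance in the new top line.
In terms of permutations the relabelling map is `r = q (π⁻¹ (n-1))` and
`b(π) = π ∘ r⁻¹`. -/
def rauzyB {n : ℕ} (π : Equiv.Perm (Fin n)) : Equiv.Perm (Fin n) :=
  if h : n = 0 then π else π * (rauzyQ (π⁻¹ ⟨n - 1, by omega⟩))⁻¹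

/-- Operation `c`: reverse the order of the entries in each line, interchange
the two lines and relabel so that the top line is again `(0, …, n-1)`.
In terms of permutations, `c(π) = w ∘ π⁻¹ ∘ w` where `w : j ↦ n - 1 - j`. -/
def rauzyC {n : ℕ} (π : Equiv.Perm (Fin n)) : Equiv.Perm (Fin n) :=
  Fin.revPerm * π⁻¹ * Fin.revPerm

/-- A permutation of `{0, …, n-1}` is irreducible if it maps no proper initial
segment `{0, …, k}` (with `k < n - 1`) to itself. -/
def IrreduciblePerm {n : ℕ} (π : Equiv.Perm (Fin n)) : Prop :=
  ∀ k : ℕ, k + 1 < n → ¬ (∀ i : Fin n, i.val ≤ k → (π i).val ≤ k)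

/-- The Rauzy class of `π`: the smallest set of permutations containing `π`
and closed under the Rauzy operations `a` and `b`. -/
def RauzyClass {n : ℕ} (π : Equiv.Perm (Fin n)) : Set (Equiv.Perm (Fin n)) :=
  {σ | ∀ S : Set (Equiv.Perm (Fin n)), π ∈ S →
    (∀ τ ∈ S, rauzyA τ ∈ S) → (∀ τ ∈ S, rauzyB τ ∈ S) → σ ∈ S}

/-- The extended Rauzy class of `π`: the smallest set of permutations
containing `π` and closed under the operations `a`, `b` and `c`. -/
def RauzyClassEx {n : ℕ} (π : Equiv.Perm (Fin n)) : Set (Equiv.Perm (Fin n)) :=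
  {σ | ∀ S : Set (Equiv.Perm (Fin n)), π ∈ S →
    (∀ τ ∈ S, rauzyA τ ∈ S) → (∀ τ ∈ S, rauzyB τ ∈ S) →
    (∀ τ ∈ S, rauzyC τ ∈ S) → σ ∈ S}

section ExtendedClass

variable {n : ℕ} {π σ : Equiv.Perm (Fin n)}

theorem RauzyClassEx.self_mem (π : Equiv.Perm (Fin n)) : π ∈ RauzyClassEx π :=
  fun _ h _ _ _ => h

theorem RauzyClassEx.rauzyA_mem (h : σ ∈ RauzyClassEx π) : rauzyA σ ∈ RauzyClassEx π :=
  fun S h₀ ha hb hc => ha _ (h S h₀ ha hb hc)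

theorem RauzyClassEx.rauzyB_mem (h : σ ∈ RauzyClassEx π) : rauzyB σ ∈ RauzyClassEx π :=
  fun S h₀ ha hb hc => hb _ (h S h₀ ha hb hc)

theorem RauzyClassEx.rauzyC_mem (h : σ ∈ RauzyClassEx π) : rauzyC σ ∈ RauzyClassEx π :=
  fun S h₀ ha hb hc => hc _ (h S h₀ ha hb hc)

theorem RauzyClassEx.subset_of_mem (h : σ ∈ RauzyClassEx π) :
    RauzyClassEx σ ⊆ RauzyClassEx π :=
  fun _ hτ => hτ _ h (fun _ => rauzyA_mem) (fun _ => rauzyB_mem) (fun _ => rauzyC_mem)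

theorem RauzyClassEx.eq_of_mem (h : σ ∈ RauzyClassEx π) (h' : π ∈ RauzyClassEx σ) :
    RauzyClassEx π = RauzyClassEx σ :=
  (subset_of_mem h').antisymm (subset_of_mem h)

/-- A function on permutations invariant under the three operations is constant on extended
Rauzy classes. -/
theorem RauzyClassEx.eq_of_invariant {α : Type*} (f : Equiv.Perm (Fin n) → α)
    (ha : ∀ τ, f (rauzyA τ) = f τ) (hb : ∀ τ, f (rauzyB τ) = f τ)
    (hc : ∀ τ, f (rauzyC τ) = f τ) (h : σ ∈ RauzyClassEx π) : f σ = f π :=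
  h {τ | f τ = f π} rfl (fun τ hτ => (ha τ).trans hτ) (fun τ hτ => (hb τ).trans hτ)
    (fun τ hτ => (hc τ).trans hτ)

/-- The effect of a word in the Rauzy operations, read from left to right;
`0`, `1` and `2` stand for `a`, `b` and `c`. -/
def rauzyWord (w : List (Fin 3)) (π : Equiv.Perm (Fin n)) : Equiv.Perm (Fin n) :=
  w.foldl (fun τ i => ![rauzyA τ, rauzyB τ, rauzyC τ] i) π

theorem RauzyClassEx.rauzyWord_mem (w : List (Fin 3)) (h : σ ∈ RauzyClassEx π) :
    rauzyWord w σ ∈ RauzyClassEx π := by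
  induction w generalizing σ with
  | nil => exact h
  | cons i w ih =>
    refine ih ?_
    fin_cases i
    exacts [rauzyA_mem h, rauzyB_mem h, rauzyC_mem h]

end ExtendedClass

section Arf

variable {n : ℕ}

theorem rauzyQ_val (m x : Fin n) :
    (rauzyQ m x).val =
      if x.val ≤ m.val then x.val else if x.val + 1 = n then m.val + 1 else x.val + 1 := by
  have hm := m.isLt
  have hx := x.isLt
  have : NeZero n := ⟨by omega⟩
  have hlt : (if x.val ≤ m.val then x.val else
      if x.val + 1 = n then m.val + 1 else x.val + 1) < n := by
    split_ifs <;> omega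
  suffices rauzyQ m x = ⟨_, hlt⟩ from congrArg Fin.val this
  rw [rauzyQ, Equiv.Perm.inv_eq_iff_eq]
  ext
  simp only [Equiv.Perm.mul_apply, Fin.revPerm_apply, Fin.val_rev]
  rcases lt_or_ge ⟨n - 2 - m.val, by omega⟩ (Fin.rev ⟨_, hlt⟩) with h | h
  · rw [Fin.cycleRange_of_gt h]
    simp only [Fin.lt_def, Fin.val_rev] at h ⊢
    split_ifs at h ⊢ <;> omega
  · rw [Fin.coe_cycleRange_of_le h]
    simp only [Fin.le_def, Fin.ext_iff, Fin.val_rev] at h ⊢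
    split_ifs at h ⊢ <;> omega

theorem rauzyB_eq (π : Equiv.Perm (Fin n)) : rauzyB π = (rauzyA π⁻¹)⁻¹ := by
  unfold rauzyA rauzyB
  split_ifs <;> simp

/-- The quadratic form over `ZMod 2` attached to `π`: every basis vector has value `1` and the
associated bilinear form records the pairs of indices that `π` puts in reverse order. -/
def rauzyForm (π : Equiv.Perm (Fin n)) (v : Fin n → ZMod 2) : ZMod 2 :=
  ∑ i, v i + ∑ i, ∑ k, if i < k ∧ π k < π i then v i * v k else 0

/-- The number of zeros of the quadratic form of `π`; it determines the Arf invariant. -/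
def rauzyFormZeros (π : Equiv.Perm (Fin n)) : ℕ :=
  Fintype.card {v : Fin n → ZMod 2 // rauzyForm π v = 0}

theorem rauzyFormZeros_congr {π σ : Equiv.Perm (Fin n)}
    (e : (Fin n → ZMod 2) ≃ (Fin n → ZMod 2))
    (h : ∀ v, rauzyForm σ v = rauzyForm π (e v)) : rauzyFormZeros σ = rauzyFormZeros π :=
  Fintype.card_congr (e.subtypeEquiv fun v => by rw [h])

theorem rauzyFormZeros_inv (π : Equiv.Perm (Fin n)) :
    rauzyFormZeros π⁻¹ = rauzyFormZeros π := by
  refine rauzyFormZeros_congr (π.symm.arrowCongr (Equiv.refl _)) fun v => ?_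
  unfold rauzyForm
  rw [← Equiv.sum_comp π, Finset.sum_comm]
  congr 1
  refine (Equiv.sum_comp π _).symm.trans ?_
  refine Finset.sum_congr rfl fun i _ => ?_
  rw [← Equiv.sum_comp π]
  refine Finset.sum_congr rfl fun k _ => ?_
  simp [and_comm, mul_comm]

theorem rauzyFormZeros_rev (π : Equiv.Perm (Fin n)) :
    rauzyFormZeros (Fin.revPerm * π * Fin.revPerm) = rauzyFormZeros π := by
  refine rauzyFormZeros_congr (Fin.revPerm.arrowCongr (Equiv.refl _)) fun v => ?_
  unfold rauzyForm
  rw [← Equiv.sum_comp Fin.revPerm, Finset.sum_comm]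
  congr 1
  refine (Equiv.sum_comp Fin.revPerm _).symm.trans ?_
  refine Finset.sum_congr rfl fun i _ => ?_
  rw [← Equiv.sum_comp Fin.revPerm]
  refine Finset.sum_congr rfl fun k _ => ?_
  simp [mul_comm]

theorem rauzyFormZeros_rauzyC (π : Equiv.Perm (Fin n)) :
    rauzyFormZeros (rauzyC π) = rauzyFormZeros π :=
  (rauzyFormZeros_rev _).trans (rauzyFormZeros_inv π)

theorem rauzyA_lt_iff {π : Equiv.Perm (Fin n)} {l j i k : Fin n} (hl : l.val + 1 = n)
    (hj : π j = l) (hik : i ≠ k) :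
    rauzyA π k < rauzyA π i ↔
      if i = j then π k ≤ π l else if k = j then π l < π i else π k < π i := by
  have hval : ∀ x, (rauzyA π x).val = if (π x).val ≤ (π l).val then (π x).val else
      if (π x).val + 1 = n then (π l).val + 1 else (π x).val + 1 := fun x => by
    have hl' : l = ⟨n - 1, by omega⟩ := Fin.ext (by simp; omega)
    rw [rauzyA, dif_neg (by omega), Equiv.Perm.mul_apply, rauzyQ_val, ← hl']
  have hmax : ∀ x, (π x).val + 1 = n ↔ x = j := fun x => by
    rw [← π.injective.eq_iff, hj, Fin.ext_iff]
    omega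
  have hne : (π i).val ≠ (π k).val := fun h => hik (π.injective (Fin.ext h))
  have h₁ := hmax i
  have h₂ := hmax k
  have h₃ := (π i).isLt
  have h₄ := (π k).isLt
  have h₅ := (π l).isLt
  rw [Fin.lt_def, hval, hval]
  simp only [Fin.lt_def, Fin.le_def]
  grind

/-- The transvection of `ZMod 2`-vectors adding the `j`-th coordinate to the `l`-th one. -/
def addCoord {l j : Fin n} (h : j ≠ l) : (Fin n → ZMod 2) ≃ (Fin n → ZMod 2) :=
  Function.Involutive.toPerm (fun v => Function.update v l (v l + v j)) fun v => by
    simp [Function.update_of_ne h, add_assoc, CharTwo.add_self_eq_zero]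

theorem rauzyForm_rauzyA {π : Equiv.Perm (Fin n)} {l j : Fin n} (hl : l.val + 1 = n)
    (hj : π j = l) (hjl : j ≠ l) (v : Fin n → ZMod 2) :
    rauzyForm (rauzyA π) v = rauzyForm π (addCoord hjl v) := by
  have hle : ∀ i : Fin n, i < l ↔ i ≠ l := fun i => by
    rw [Fin.lt_def, Ne, Fin.ext_iff]; omega
  have hmax : ∀ i : Fin n, π i ≤ π j := fun i => by
    rw [hj, Fin.le_def]; omega
  have hu : ∀ i, addCoord hjl v i = v i + if i = l then v j else 0 := fun i => by
    change Function.update v l (v l + v j) i = _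
    by_cases h : i = l
    · subst h; simp
    · simp [h]
  have hcross : ∀ i k, (if i < k ∧ rauzyA π k < rauzyA π i then v i * v k else 0) =
      (if i < k ∧ π k < π i then v i * v k else 0) +
      ((if k = j then if i < j ∧ π l < π i then v i * v j else 0 else 0) +
      (if i = j then if j < k ∧ π l < π k then v k * v j else 0 else 0)) := fun i k => by
    by_cases hik : i < k
    · simp only [rauzyA_lt_iff hl hj hik.ne]
      have := CharTwo.add_self_eq_zero (v i * v k)
      have := hmax i
      have := hmax k
      have hne : π i ≠ π k := fun h => hik.ne (π.injective h)
      grind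
    · grind
  have hform : ∀ i k, (if i < k ∧ π k < π i then addCoord hjl v i * addCoord hjl v k else 0) =
      (if i < k ∧ π k < π i then v i * v k else 0) +
      (if k = l then if π l < π i then v i * v j else 0 else 0) := fun i k => by
    have := hle i
    have := hle k
    rw [hu, hu]
    grind
  have hsplit : ∀ i, (if π l < π i then v i * v j else 0) =
      (if i = j then v j else 0) + ((if i < j ∧ π l < π i then v i * v j else 0) +
        if j < i ∧ π l < π i then v i * v j else 0) := fun i => by
    have hlj : π l < π j := lt_of_le_of_ne (hmax l) fun h => hjl (π.injective h.symm)
    have hsq : v j * v j = v j := by generalize v j = x; revert x; decide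
    rcases lt_trichotomy i j with h | rfl | h
    · simp [h, h.ne, h.not_gt]
    · simp [hlj, hsq]
    · simp [h, h.ne', h.not_gt]
  unfold rauzyForm
  simp only [hcross, hform, Finset.sum_add_distrib, Finset.sum_ite_eq', Finset.mem_univ, if_true,
    hsplit]
  simp only [hu, Finset.sum_add_distrib, Finset.sum_ite_eq', Finset.mem_univ, if_true]
  rw [Finset.sum_comm (f := fun i k => if i = j then if j < k ∧ π l < π k then v k * v j else 0
    else 0)]
  simp only [Finset.sum_ite_eq', Finset.mem_univ, if_true]
  linear_combination - CharTwo.add_self_eq_zero (v j)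

theorem rauzyFormZeros_rauzyA (π : Equiv.Perm (Fin n)) :
    rauzyFormZeros (rauzyA π) = rauzyFormZeros π := by
  rcases n.eq_zero_or_pos with rfl | hn
  · rw [Subsingleton.elim (rauzyA π) π]
  let l : Fin n := ⟨n - 1, by omega⟩
  have hl : l.val + 1 = n := Nat.sub_add_cancel hn
  by_cases h : π⁻¹ l = l
  · congr 1
    ext x
    have hx := (π x).isLt
    have hπ : π l = l := (Equiv.Perm.inv_eq_iff_eq.1 h).symm
    have hπ' : π ⟨n - 1, by omega⟩ = l := hπ
    rw [rauzyA, dif_neg hn.ne', Equiv.Perm.mul_apply, rauzyQ_val, hπ', if_pos (by omega)]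
  · exact rauzyFormZeros_congr (addCoord h) (rauzyForm_rauzyA hl (by simp) h)

theorem rauzyFormZeros_rauzyB (π : Equiv.Perm (Fin n)) :
    rauzyFormZeros (rauzyB π) = rauzyFormZeros π := by
  rw [rauzyB_eq, rauzyFormZeros_inv, rauzyFormZeros_rauzyA, rauzyFormZeros_inv]

end Arf

/-- The inverse of the permutation with bottom line `(7,6,5,4,3,9,8,2,1)`. -/
def h24EvenFst : Equiv.Perm (Fin 9) :=
  ⟨![6,5,4,3,2,8,7,1,0], ![8,7,4,3,2,1,0,6,5], by decide, by decide⟩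

/-- The inverse of the permutation with bottom line `(6,5,4,3,7,9,8,2,1)`. -/
def h24EvenSnd : Equiv.Perm (Fin 9) :=
  ⟨![5,4,3,2,6,8,7,1,0], ![8,7,3,2,1,0,4,6,5], by decide, by decide⟩

/-- The inverse of the permutation with bottom line `(4,3,5,7,6,9,8,2,1)`. -/
def h24OddFst : Equiv.Perm (Fin 9) :=
  ⟨![3,2,4,6,5,8,7,1,0], ![8,7,1,0,2,4,3,6,5], by decide, by decide⟩

/-- The inverse of the permutation with bottom line `(4,3,6,5,7,9,8,2,1)`. -/
def h24OddSnd : Equiv.Perm (Fin 9) :=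
  ⟨![3,2,5,4,6,8,7,1,0], ![8,7,1,0,3,2,4,6,5], by decide, by decide⟩

theorem rauzyC_h24OddFst : rauzyC h24OddFst⁻¹ = h24OddSnd⁻¹ := by decide +kernel

theorem rauzyC_h24OddSnd : rauzyC h24OddSnd⁻¹ = h24OddFst⁻¹ := by decide +kernel

theorem rauzyWord_h24EvenFst :
    rauzyWord [1, 0, 1, 1, 0, 1, 0, 1, 1, 0, 1, 1, 0, 0, 2, 0, 0, 1, 1, 0, 0] h24EvenFst⁻¹ = h24EvenSnd⁻¹ := by decide +kernel

theorem rauzyWord_h24EvenSnd :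
    rauzyWord [0, 1, 1, 1, 0, 1, 1, 0, 2, 1, 1, 0, 1, 0, 1, 1, 0, 0, 1, 1, 2, 1] h24EvenSnd⁻¹ = h24EvenFst⁻¹ := by decide +kernel

theorem rauzyFormZeros_h24EvenFst : rauzyFormZeros h24EvenFst⁻¹ = 272 := by decide +kernel

theorem rauzyFormZeros_h24OddFst : rauzyFormZeros h24OddFst⁻¹ = 240 := by decide +kernel

/-- The permutations of `{1, …, 9}` with bottom lines
`(7,6,5,4,3,9,8,2,1)`, `(6,5,4,3,7,9,8,2,1)`, `(4,3,5,7,6,9,8,2,1)` and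
`(4,3,6,5,7,9,8,2,1)` are all irreducible; the first two share an extended
Rauzy class, the last two share an extended Rauzy class, and these two
extended Rauzy classes are distinct (even-spin and odd-spin components of
`H(2,4)` in genus `4`). -/
theorem rauzyClassEx_H24_distinct (π₁ π₂ π₃ π₄ : Equiv.Perm (Fin 9))
    (hπ₁ : ∀ i, π₁⁻¹ i = ![6,5,4,3,2,8,7,1,0] i)
    (hπ₂ : ∀ i, π₂⁻¹ i = ![5,4,3,2,6,8,7,1,0] i)
    (hπ₃ : ∀ i, π₃⁻¹ i = ![3,2,4,6,5,8,7,1,0] i)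
    (hπ₄ : ∀ i, π₄⁻¹ i = ![3,2,5,4,6,8,7,1,0] i) :
    IrreduciblePerm π₁ ∧ IrreduciblePerm π₂ ∧ IrreduciblePerm π₃ ∧
      IrreduciblePerm π₄ ∧
      RauzyClassEx π₁ = RauzyClassEx π₂ ∧ RauzyClassEx π₃ = RauzyClassEx π₄ ∧
      RauzyClassEx π₁ ≠ RauzyClassEx π₃ := by
  obtain rfl : h24EvenFst⁻¹ = π₁ := inv_eq_iff_eq_inv.2 (Equiv.ext hπ₁).symm
  obtain rfl : h24EvenSnd⁻¹ = π₂ := inv_eq_iff_eq_inv.2 (Equiv.ext hπ₂).symm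
  obtain rfl : h24OddFst⁻¹ = π₃ := inv_eq_iff_eq_inv.2 (Equiv.ext hπ₃).symm
  obtain rfl : h24OddSnd⁻¹ = π₄ := inv_eq_iff_eq_inv.2 (Equiv.ext hπ₄).symm
  refine ⟨?_, ?_, ?_, ?_, ?_, ?_, fun h => ?_⟩
  · intro k hk
    have : k < 8 := by omega
    interval_cases k <;> decide
  · intro k hk
    have : k < 8 := by omega
    interval_cases k <;> decide
  · intro k hk
    have : k < 8 := by omega
    interval_cases k <;> decide
  · intro k hk
    have : k < 8 := by omega
    interval_cases k <;> decide
  · refine RauzyClassEx.eq_of_mem ?_ ?_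
    · exact rauzyWord_h24EvenFst ▸ RauzyClassEx.rauzyWord_mem _ (RauzyClassEx.self_mem _)
    · exact rauzyWord_h24EvenSnd ▸ RauzyClassEx.rauzyWord_mem _ (RauzyClassEx.self_mem _)
  · refine RauzyClassEx.eq_of_mem ?_ ?_
    · exact rauzyC_h24OddFst ▸ RauzyClassEx.rauzyC_mem (RauzyClassEx.self_mem _)
    · exact rauzyC_h24OddSnd ▸ RauzyClassEx.rauzyC_mem (RauzyClassEx.self_mem _)
  · have key := RauzyClassEx.eq_of_invariant rauzyFormZeros rauzyFormZeros_rauzyA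
      rauzyFormZeros_rauzyB rauzyFormZeros_rauzyC (h ▸ RauzyClassEx.self_mem h24EvenFst⁻¹)
    rw [rauzyFormZeros_h24EvenFst, rauzyFormZeros_h24OddFst] at key
    omega
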